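/- arXiv:2308.14314 — 3 statements merged into one kernel-verified Lean document; each statement's English description precedes it below -/
import Mathlib

section
/- The NSA iterates satisfy ∑_{k=1}^∞ (k+p)·δ_k < ∞, i.e. the series of weighted optimality gaps converges. -/
theorem nsa_grad {n : ℕ}
    (f : EuclideanSpace ℝ (Fin n) → ℝ)
    (hconv : ConvexOn ℝ Set.univ f)
    (hdiff : Differentiable ℝ f) (a b : EuclideanSpace ℝ (Fin n)) :
    f a + inner ℝ (gradient f a) (b - a) ≤ f b := by
  have h1 : ConvexOn ℝ Set.univ (fun t : ℝ => f (AffineMap.lineMap a b t)) := by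
    have := hconv.comp_affineMap (AffineMap.lineMap (k := ℝ) a b)
    rw [Set.preimage_univ] at this
    exact this
  have h2 : HasDerivAt (fun t : ℝ => f (AffineMap.lineMap a b t))
      (inner ℝ (gradient f a) (b - a)) 0 := by
    have hg := (hdiff a).hasGradientAt.hasFDerivAt
    have hl : HasDerivAt (fun t : ℝ => AffineMap.lineMap (k := ℝ) a b t) (b - a) 0 :=
      AffineMap.hasDerivAt_lineMap
    have h0 : AffineMap.lineMap (k := ℝ) a b (0:ℝ) = a := by simp
    rw [← h0] at hg
    have := hg.comp_hasDerivAt (0:ℝ) hl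
    rw [h0, InnerProductSpace.toDual_apply_apply] at this
    exact this
  have h3 := h1.le_slope_of_hasDerivAt (Set.mem_univ 0) (Set.mem_univ 1) (by norm_num) h2
  rw [slope_def_field] at h3
  simp only [AffineMap.lineMap_apply_one, AffineMap.lineMap_apply_zero, sub_zero, div_one] at h3
  linarith

theorem nsa_half {n : ℕ}
    (f : EuclideanSpace ℝ (Fin n) → ℝ)
    (hconv : ConvexOn ℝ Set.univ f)
    (hdiff : Differentiable ℝ f)
    (L : ℝ)
    (hlip : ∀ x x' : EuclideanSpace ℝ (Fin n),
      ‖gradient f x - gradient f x'‖ ≤ L * ‖x - x'‖)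
    (c d : ℝ) (hc : 0 ≤ c) (hd : 0 ≤ d) (y : EuclideanSpace ℝ (Fin n)) :
    f (y - (c + d) • gradient f y)
      ≤ f (y - c • gradient f y) - d * (1 - L * (c + d)) * ‖gradient f y‖ ^ 2 := by
  set g := gradient f y with hg
  set h := gradient f (y - (c + d) • g) with hh
  have h1 := nsa_grad f hconv hdiff (y - (c + d) • g) (y - c • g)
  rw [show y - c • g - (y - (c + d) • g) = d • g by module, inner_smul_right, ← hh] at h1
  have h2 := hlip y (y - (c + d) • g)
  rw [← hg, ← hh, show y - (y - (c + d) • g) = (c + d) • g by module, norm_smul,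
    Real.norm_of_nonneg (by positivity)] at h2
  have h3 := real_inner_le_norm (g - h) g
  rw [inner_sub_left, real_inner_self_eq_norm_sq] at h3
  have h4 := mul_le_mul_of_nonneg_right h2 (norm_nonneg g)
  have h5 : d * (‖g‖ ^ 2 - inner ℝ h g) ≤ d * (L * ((c + d) * ‖g‖) * ‖g‖) :=
    mul_le_mul_of_nonneg_left (h3.trans h4) hd
  nlinarith

theorem nsa_desc {n : ℕ}
    (f : EuclideanSpace ℝ (Fin n) → ℝ)
    (hconv : ConvexOn ℝ Set.univ f)
    (hdiff : Differentiable ℝ f)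
    (L : ℝ) (hL : 0 < L)
    (hlip : ∀ x x' : EuclideanSpace ℝ (Fin n),
      ‖gradient f x - gradient f x'‖ ≤ L * ‖x - x'‖)
    (η : ℝ) (hη0 : 0 < η) (hη : η ≤ 2 / (3 * L)) (y : EuclideanSpace ℝ (Fin n)) :
    f (y - η • gradient f y) ≤ f y - η / 2 * ‖gradient f y‖ ^ 2 := by
  have h1 := nsa_half f hconv hdiff L hlip 0 (η / 2) le_rfl (by positivity) y
  have h2 := nsa_half f hconv hdiff L hlip (η / 2) (η / 2) (by positivity) (by positivity) y
  rw [add_halves] at h2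
  simp only [zero_add, zero_smul, sub_zero] at h1
  rw [le_div_iff₀ (by positivity)] at hη
  have h3 : 0 ≤ (2 - η * (3 * L)) * (η * ‖gradient f y‖ ^ 2) :=
    mul_nonneg (by linarith) (by positivity)
  nlinarith

theorem nsa_stmt_5 (n : ℕ) (hn : 1 ≤ n)
    (f : EuclideanSpace ℝ (Fin n) → ℝ)
    (hconv : ConvexOn ℝ Set.univ f)
    (hdiff : Differentiable ℝ f)
    (L : ℝ) (hL : 0 < L)
    (hlip : ∀ x x' : EuclideanSpace ℝ (Fin n),
      ‖gradient f x - gradient f x'‖ ≤ L * ‖x - x'‖)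
    (xstar : EuclideanSpace ℝ (Fin n)) (hmin : ∀ u, f xstar ≤ f u)
    (p : ℝ) (hp : 3 ≤ p)
    (η : ℝ) (hη0 : 0 < η) (hη : η ≤ 2 / (3 * L))
    (α : ℕ → ℝ) (hα : ∀ k : ℕ, α k = p / (k + p))
    (x y z : ℕ → EuclideanSpace ℝ (Fin n))
    (hx0 : x 0 = z 0)
    (hy : ∀ k, y k = (1 - α k) • x k + α k • z k)
    (hx : ∀ k, x (k + 1) =
      if f (y k - η • gradient f (y k)) ≤ f (x k - η • gradient f (x k))
      then y k - η • gradient f (y k)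
      else x k - η • gradient f (x k))
    (hz : ∀ k, z (k + 1) = z k - (η / α k) • gradient f (y k))
    :
    Summable (fun k : ℕ => ((k : ℝ) + p) * (f (x k) - f xstar)) := by
  have hδ : ∀ k, 0 ≤ f (x k) - f xstar := fun k => sub_nonneg.2 (hmin _)
  obtain ⟨V, hV⟩ : ∃ V : ℕ → ℝ, ∀ k, V k = η * (((k : ℝ) + p - 1) / p) ^ 2 * (f (x k) - f xstar)
    + 1 / 2 * ‖z k - xstar‖ ^ 2 := ⟨_, fun _ => rfl⟩
  have hV0 : ∀ k, 0 ≤ V k := fun k => by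
    rw [hV]; have := hδ k; positivity
  have key : ∀ k : ℕ, V (k + 1) + η / p ^ 2 * (((k : ℝ) + p) * (f (x k) - f xstar)) ≤ V k := by
    intro k
    have hk : (0 : ℝ) ≤ k := Nat.cast_nonneg k
    obtain ⟨t, ht⟩ : ∃ t : ℝ, t = ((k : ℝ) + p) / p := ⟨_, rfl⟩
    have ht1 : 1 ≤ t := by rw [ht, le_div_iff₀ (by linarith)]; linarith
    have hat : α k = 1 / t := by rw [hα, ht]; field_simp
    have ht0 : t ≠ 0 := by positivity
    obtain ⟨g, hg⟩ : ∃ g, g = gradient f (y k) := ⟨_, rfl⟩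
    have hstep : f (x (k + 1)) ≤ f (y k) - η / 2 * ‖g‖ ^ 2 := by
      have h := nsa_desc f hconv hdiff L hL hlip η hη0 hη (y k)
      rw [hx, hg]
      split_ifs with hc
      · exact h
      · exact (not_le.1 hc).le.trans h
    have c1 := nsa_grad f hconv hdiff (y k) xstar
    have c2 := nsa_grad f hconv hdiff (y k) (x k)
    rw [← hg] at c1 c2
    have hzc : z k - xstar = -((t - 1) • (x k - y k) + (xstar - y k)) := by
      have : t • y k = (t - 1) • x k + z k := by
        rw [hy, hat, smul_add, smul_smul, smul_smul]
        rw [show t * (1 - 1 / t) = t - 1 by field_simp, show t * (1 / t) = 1 by field_simp,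
          one_smul]
      have hz' : z k = t • y k - (t - 1) • x k := by rw [this]; abel
      rw [hz']; module
    have hin : inner ℝ (z k - xstar) g
        = -((t - 1) * inner ℝ g (x k - y k) + inner ℝ g (xstar - y k)) := by
      rw [real_inner_comm, hzc, inner_neg_right, inner_add_right, inner_smul_right]
    have hE : ‖z (k + 1) - xstar‖ ^ 2
        = ‖z k - xstar‖ ^ 2 - 2 * (η * t) * inner ℝ (z k - xstar) g + (η * t) ^ 2 * ‖g‖ ^ 2 := by
      rw [hz, ← hg, hat, show η / (1 / t) = η * t by field_simp,
        show z k - (η * t) • g - xstar = (z k - xstar) - (η * t) • g by abel,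
        norm_sub_sq_real, inner_smul_right, norm_smul, mul_pow, Real.norm_eq_abs, sq_abs]
      ring
    have hcoef : t * (t - 1) + ((k : ℝ) + p) / p ^ 2 ≤ (((k : ℝ) + p - 1) / p) ^ 2 := by
      have : (((k : ℝ) + p - 1) / p) ^ 2 - (t * (t - 1) + ((k : ℝ) + p) / p ^ 2)
        = (k * (p - 3) + ((p - 1) ^ 2 - p)) / p ^ 2 := by
        rw [ht]; field_simp; ring
      have h2 : 0 ≤ (k * (p - 3) + ((p - 1) ^ 2 - p)) / p ^ 2 := by
        apply div_nonneg _ (by positivity)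
        have : 0 ≤ k * (p - 3) := mul_nonneg hk (by linarith)
        nlinarith
      linarith
    have m1 := mul_le_mul_of_nonneg_left (mul_le_mul_of_nonneg_right hcoef (hδ k)) hη0.le
    have m2 : (t - 1) * (f (y k) + inner ℝ g (x k - y k)) ≤ (t - 1) * f (x k) :=
      mul_le_mul_of_nonneg_left c2 (by linarith)
    have m3 : t * (f (y k) - f xstar) - (t - 1) * (f (x k) - f xstar)
        ≤ inner ℝ (z k - xstar) g := by rw [hin]; linarith
    have m4 := mul_le_mul_of_nonneg_left m3 (show 0 ≤ η * t by positivity)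
    have m5 := mul_le_mul_of_nonneg_left hstep (show 0 ≤ η * t ^ 2 by positivity)
    have e1 : (((k + 1 : ℕ) : ℝ) + p - 1) / p = t := by rw [ht]; push_cast; ring
    rw [hV, hV, hE, e1]
    have e2 : η / p ^ 2 * (((k : ℝ) + p) * (f (x k) - f xstar))
      = η * (((k : ℝ) + p) / p ^ 2 * (f (x k) - f xstar)) := by ring
    rw [e2]
    linarith
  have hp2 : 0 < η / p ^ 2 := by positivity
  have hsum : ∀ N : ℕ, V N + ∑ k ∈ Finset.range N,
      η / p ^ 2 * (((k : ℝ) + p) * (f (x k) - f xstar)) ≤ V 0 := by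
    intro N
    induction N with
    | zero => simp
    | succ N ih => rw [Finset.sum_range_succ]; linarith [key N]
  have hs : Summable (fun k : ℕ => η / p ^ 2 * (((k : ℝ) + p) * (f (x k) - f xstar))) := by
    apply summable_of_sum_range_le (c := V 0)
    · intro k; have := hδ k; positivity
    · intro N; linarith [hsum N, hV0 N]
  exact (summable_mul_left_iff hp2.ne').1 hs
end

section
/- The NSA iterates with inexact gradients and projection satisfy lim_{k→∞} k²·(f(x_k) − f*) = 0 and liminf_{k→∞} k²·(log k)·(log log k)·(f(x_k) − f*) = 0. -/
open scoped RealInnerProductSpace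
section
variable {E : Type*} [NormedAddCommGroup E] [InnerProductSpace ℝ E] [CompleteSpace E]

theorem nsa_line_deriv (f : E → ℝ) (hdiff : Differentiable ℝ f) (x v : E) (t : ℝ) :
    HasDerivAt (fun s : ℝ => f (x + s • v)) ⟪gradient f (x + t • v), v⟫ t := by
  have h1 := (hdiff (x + t • v)).hasGradientAt.hasFDerivAt
  have h2 : HasDerivAt (fun s : ℝ => x + s • v) v t := by
    simpa using ((hasDerivAt_id t).smul_const v).const_add x
  have h3 := h1.comp_hasDerivAt t h2
  have e : ⟪gradient f (x + t • v), v⟫ = (InnerProductSpace.toDual ℝ E (gradient f (x + t • v))) v := by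
    rw [InnerProductSpace.toDual_apply_apply]
  rw [e]
  exact h3

theorem nsa_descent (f : E → ℝ) (hdiff : Differentiable ℝ f) (L : ℝ)
    (hlip : ∀ x x' : E, ‖gradient f x - gradient f x'‖ ≤ L * ‖x - x'‖) (x v : E) :
    f (x + v) ≤ f x + ⟪gradient f x, v⟫ + L / 2 * ‖v‖ ^ 2 := by
  have hd : ∀ t : ℝ, HasDerivAt
      (fun s : ℝ => f (x + s • v) - s * ⟪gradient f x, v⟫ - L / 2 * ‖v‖ ^ 2 * s ^ 2)
      (⟪gradient f (x + t • v), v⟫ - ⟪gradient f x, v⟫ - L / 2 * ‖v‖ ^ 2 * (2 * t)) t := by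
    intro t
    have h1 := nsa_line_deriv f hdiff x v t
    have h2 := (hasDerivAt_id t).mul_const ⟪gradient f x, v⟫
    have h3 := (hasDerivAt_pow 2 t).const_mul (L / 2 * ‖v‖ ^ 2)
    have h4 := (h1.sub h2).sub h3
    have e : ⟪gradient f (x + t • v), v⟫ - ⟪gradient f x, v⟫ - L / 2 * ‖v‖ ^ 2 * (2 * t)
      = ⟪gradient f (x + t • v), v⟫ - 1 * ⟪gradient f x, v⟫
        - L / 2 * ‖v‖ ^ 2 * (((2 : ℕ) : ℝ) * t ^ (2 - 1)) := by norm_num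
    rw [e]
    exact h4
  have ha := antitoneOn_of_deriv_nonpos (convex_Icc (0 : ℝ) 1)
    (fun t _ => (hd t).continuousAt.continuousWithinAt)
    (fun t _ => (hd t).differentiableAt.differentiableWithinAt) (by
      intro t ht
      rw [interior_Icc] at ht
      rw [(hd t).deriv]
      have e : ⟪gradient f (x + t • v), v⟫ - ⟪gradient f x, v⟫
          = ⟪gradient f (x + t • v) - gradient f x, v⟫ := by rw [inner_sub_left]
      have h4 := real_inner_le_norm (gradient f (x + t • v) - gradient f x) v
      have h5 := hlip (x + t • v) x
      have h6 : ‖x + t • v - x‖ = t * ‖v‖ := by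
        rw [add_sub_cancel_left, norm_smul, Real.norm_of_nonneg ht.1.le]
      rw [h6] at h5
      have h7 := mul_le_mul_of_nonneg_right h5 (norm_nonneg v)
      rw [e]; nlinarith)
  have := ha (Set.left_mem_Icc.2 zero_le_one) (Set.right_mem_Icc.2 zero_le_one) zero_le_one
  simp only [one_smul, zero_smul, add_zero, zero_mul, one_mul, one_pow, sub_zero, mul_one,
    ne_eq, OfNat.ofNat_ne_zero, not_false_eq_true, zero_pow, mul_zero] at this
  linarith

theorem nsa_convex (f : E → ℝ) (hconv : ConvexOn ℝ Set.univ f)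
    (hdiff : Differentiable ℝ f) (y u : E) :
    f y + ⟪gradient f y, u - y⟫ ≤ f u := by
  have hc : ConvexOn ℝ Set.univ (fun s : ℝ => f (y + s • (u - y))) := by
    refine ⟨convex_univ, fun a _ b _ c d hc hd hcd => ?_⟩
    have := hconv.2 (Set.mem_univ (y + a • (u - y))) (Set.mem_univ (y + b • (u - y))) hc hd hcd
    refine le_trans (le_of_eq ?_) this
    show f _ = f _
    congr 1
    have : y = (c + d) • y := by rw [hcd, one_smul]
    simp only [smul_eq_mul]
    nth_rewrite 1 [this]
    module
  have h := nsa_line_deriv f hdiff y (u - y) 0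
  have := hc.le_slope_of_hasDerivAt (Set.mem_univ 0) (Set.mem_univ 1) zero_lt_one h
  simp only [slope, zero_smul, add_zero, one_smul, sub_zero, inv_one, vsub_eq_sub,
    add_sub_cancel] at this
  linarith

theorem nsa_proj (μ : ℝ) (w z u : E) (hz : z ∈ Metric.closedBall (0 : E) μ)
    (hu : u ∈ Metric.closedBall (0 : E) μ)
    (h : ∀ v ∈ Metric.closedBall (0 : E) μ, ‖w - z‖ ≤ ‖w - v‖) :
    ‖z - u‖ ^ 2 ≤ ‖w - u‖ ^ 2 := by
  have hn : ‖w - z‖ = ⨅ v : Metric.closedBall (0 : E) μ, ‖w - v‖ := by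
    have : Nonempty (Metric.closedBall (0 : E) μ) := ⟨⟨z, hz⟩⟩
    refine le_antisymm (le_ciInf fun v => h v v.2) ?_
    exact ciInf_le (f := fun v : Metric.closedBall (0 : E) μ => ‖w - v‖)
      ⟨0, by rintro _ ⟨v, rfl⟩; exact norm_nonneg _⟩ ⟨z, hz⟩
  have h1 := (norm_eq_iInf_iff_real_inner_le_zero (convex_closedBall (0 : E) μ) hz).1 hn u hu
  have e : w - u = (w - z) + (z - u) := by abel
  rw [e, norm_add_sq_real]
  have e2 : ⟪w - z, u - z⟫ = - ⟪w - z, z - u⟫ := by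
    rw [← inner_neg_right, neg_sub]
  nlinarith [sq_nonneg ‖w - z‖]

/-- one step of the Lyapunov inequality -/
theorem nsa_step (f : E → ℝ) (hconv : ConvexOn ℝ Set.univ f)
    (hdiff : Differentiable ℝ f) (L : ℝ) (hL : 0 < L)
    (hlip : ∀ x x' : E, ‖gradient f x - gradient f x'‖ ≤ L * ‖x - x'‖)
    (η : ℝ) (hη0 : 0 < η) (hη : η ≤ 1 / (4 * L)) (y g : E)
    (hg : (3 / 4) * ‖g‖ ^ 2 ≤ ⟪g, gradient f y⟫) :
    f (y - (2 * η) • g) ≤ f y - η * ‖g‖ ^ 2 := by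
  have h := nsa_descent f hdiff L hlip y (-((2 * η) • g))
  rw [← sub_eq_add_neg, inner_neg_right, inner_smul_right, norm_neg, norm_smul,
    Real.norm_of_nonneg (by positivity), real_inner_comm] at h
  have h1 : η * (4 * L) ≤ 1 := by rwa [le_div_iff₀ (by positivity)] at hη
  have h2 : η * (L * η) * ‖g‖ ^ 2 ≤ η * (1 / 4) * ‖g‖ ^ 2 := by
    gcongr; linarith
  nlinarith [mul_le_mul_of_nonneg_left hg hη0.le]

theorem nsa_lyap (f : E → ℝ) (hconv : ConvexOn ℝ Set.univ f)
    (hdiff : Differentiable ℝ f) (η a c μ : ℝ) (hη0 : 0 < η) (ha : 0 < a) (ha1 : a ≤ 1)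
    (s x y z z' g : E) (F : ℝ) (hs : ‖s‖ ≤ μ) (hz : ‖z‖ ≤ μ) (hc : ‖g - gradient f y‖ ≤ c)
    (hy : y = (1 - a) • x + a • z) (hF : F ≤ f y - η * ‖g‖ ^ 2)
    (hz' : ‖z' - s‖ ^ 2 ≤ ‖z - (η / a) • g - s‖ ^ 2) :
    ‖z' - s‖ ^ 2 / 2 + η / a ^ 2 * (F - f s) ≤
      ‖z - s‖ ^ 2 / 2 + η * (1 - a) / a ^ 2 * (f x - f s) + η / a * (c * (2 * μ)) := by
  have e : z - (η / a) • g - s = (z - s) - (η / a) • g := by abel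
  rw [e, norm_sub_sq_real (z - s), inner_smul_right, norm_smul, Real.norm_of_nonneg (by positivity),
    real_inner_comm] at hz'
  have h1 := nsa_convex f hconv hdiff y x
  have h2 := nsa_convex f hconv hdiff y s
  have h3 : a * ⟪gradient f y, z - s⟫ =
      - ((1 - a) * ⟪gradient f y, x - y⟫ + a * ⟪gradient f y, s - y⟫) := by
    rw [← inner_smul_right, ← inner_smul_right, ← inner_smul_right, ← inner_add_right,
      ← inner_neg_right]
    congr 1
    rw [hy]; module
  have h4 : ⟪g, z - s⟫ = ⟪gradient f y, z - s⟫ + ⟪g - gradient f y, z - s⟫ := by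
    rw [inner_sub_left]; ring
  have h5 : -(c * (2 * μ)) ≤ ⟪g - gradient f y, z - s⟫ := by
    have := abs_le.1 (abs_real_inner_le_norm (g - gradient f y) (z - s))
    have h6 : ‖z - s‖ ≤ 2 * μ := by linarith [norm_sub_le z s]
    have := mul_le_mul hc h6 (norm_nonneg _) ((norm_nonneg _).trans hc)
    linarith
  have h7 : f y - f s - (1 - a) * (f x - f s) - a * (c * (2 * μ)) ≤ a * ⟪g, z - s⟫ := by
    rw [h4, mul_add, h3]
    nlinarith [mul_le_mul_of_nonneg_left h5 ha.le, mul_le_mul_of_nonneg_left h1 (sub_nonneg.2 ha1),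
      mul_le_mul_of_nonneg_left h2 ha.le]
  have h8 : F + η * ‖g‖ ^ 2 - f s - (1 - a) * (f x - f s) - a * (c * (2 * μ)) ≤ a * ⟪g, z - s⟫ := by
    linarith
  have h9 := mul_le_mul_of_nonneg_left h8 (show 0 ≤ η / a ^ 2 by positivity)
  have e1 : η / a ^ 2 * (a * ⟪g, z - s⟫) = η / a * ⟪g, z - s⟫ := by field_simp
  have e2 : η / a ^ 2 * (F + η * ‖g‖ ^ 2 - f s - (1 - a) * (f x - f s) - a * (c * (2 * μ)))
    = η / a ^ 2 * (F - f s) + (η / a * ‖g‖) ^ 2 - η * (1 - a) / a ^ 2 * (f x - f s)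
      - η / a * (c * (2 * μ)) := by field_simp; ring
  rw [e1, e2] at h9
  nlinarith [sq_nonneg (η / a * ‖g‖)]
end

theorem nsa_tendsto (d : ℕ → ℝ) (hd : ∀ k, 0 ≤ d k) (hanti : Antitone d)
    (hs : Summable fun k : ℕ => (k : ℝ) * d k) :
    Filter.Tendsto (fun k : ℕ => (k : ℝ) ^ 2 * d k) Filter.atTop (nhds 0) := by
  -- tails
  have ht := hs.tendsto_sum_tsum_nat
  have hhalf : Filter.Tendsto (fun k : ℕ => k / 2) Filter.atTop Filter.atTop :=
    Nat.tendsto_div_const_atTop (by norm_num)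
  have h1 := (ht.sub (ht.comp hhalf)).const_mul 8
  simp only [sub_self, mul_zero] at h1
  have h1' : Filter.Tendsto (fun k : ℕ => 8 * (∑ i ∈ Finset.range (k + 1), (i : ℝ) * d i
      - ∑ i ∈ Finset.range ((k + 1) / 2), (i : ℝ) * d i)) Filter.atTop (nhds 0) :=
    h1.comp (Filter.tendsto_add_atTop_nat 1)
  refine squeeze_zero (fun k => mul_nonneg (sq_nonneg _) (hd k)) (fun k => ?_) h1'
  have h2 : (k + 1) / 2 ≤ k + 1 := Nat.div_le_self _ _
  rw [← Finset.sum_Ico_eq_sub _ h2]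
  have h3 : ∀ i ∈ Finset.Ico ((k + 1) / 2) (k + 1), (k : ℝ) / 2 * d k ≤ (i : ℝ) * d i := by
    intro i hi
    rw [Finset.mem_Ico] at hi
    have : (k : ℝ) ≤ 2 * i := by
      have : k ≤ 2 * i := by omega
      exact_mod_cast this
    exact mul_le_mul (by linarith) (hanti (by omega)) (hd k) (by positivity)
  have h4 := Finset.card_nsmul_le_sum _ _ _ h3
  rw [Nat.card_Ico, nsmul_eq_mul] at h4
  have h5 : (k : ℝ) / 2 ≤ ((k + 1 - (k + 1) / 2 : ℕ) : ℝ) := by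
    have : k ≤ 2 * (k + 1 - (k + 1) / 2) := by omega
    have : (k : ℝ) ≤ 2 * ((k + 1 - (k + 1) / 2 : ℕ) : ℝ) := by exact_mod_cast this
    linarith
  have h6 : 0 ≤ (k : ℝ) / 2 * d k := mul_nonneg (by positivity) (hd k)
  have h7 := mul_le_mul_of_nonneg_right h5 h6
  nlinarith

theorem nsa_log (a b : ℝ) (ha : 0 < a) (hab : a ≤ b) :
    Real.log b - Real.log a ≤ (b - a) / a := by
  have hb : 0 < b := by linarith
  rw [← Real.log_div hb.ne' ha.ne']
  have := Real.log_le_sub_one_of_pos (div_pos hb ha)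
  rw [sub_div, div_self ha.ne']; exact this

theorem nsa_not_summable (d : ℕ → ℝ) (c : ℝ) (hc : 0 < c)
    (h : ∀ᶠ k : ℕ in Filter.atTop,
      c ≤ (k : ℝ) ^ 2 * Real.log k * Real.log (Real.log k) * d k)
    (hs : Summable fun k : ℕ => (k : ℝ) * d k) : False := by
  have hcast : Filter.Tendsto (fun k : ℕ => (k : ℝ)) Filter.atTop Filter.atTop :=
    tendsto_natCast_atTop_atTop
  have hl := Real.tendsto_log_atTop
  have l1 := hl.comp hcast
  have l2 := hl.comp l1
  have l3 := hl.comp l2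
  have hev := h.and ((hcast.eventually_gt_atTop 0).and
    ((l1.eventually_gt_atTop 0).and (l2.eventually_gt_atTop 0)))
  obtain ⟨N, hN⟩ := Filter.eventually_atTop.1 hev
  have hstep : ∀ k ≥ N, c * (Real.log (Real.log (Real.log ((k + 1 : ℕ) : ℝ)))
      - Real.log (Real.log (Real.log (k : ℝ)))) ≤ (k : ℝ) * d k := by
    intro k hk
    obtain ⟨h1, h2, h3, h4⟩ := hN k hk
    simp only [Function.comp] at h3 h4
    have hkk : (k : ℝ) ≤ ((k + 1 : ℕ) : ℝ) := by push_cast; linarith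
    have m1 := Real.log_le_log h2 hkk
    have m2 := Real.log_le_log h3 m1
    have s1 := nsa_log _ _ h2 hkk
    have s2 := nsa_log _ _ h3 m1
    have s3 := nsa_log _ _ h4 m2
    have e1 : ((k + 1 : ℕ) : ℝ) - k = 1 := by push_cast; ring
    rw [e1] at s1
    have s4 := s2.trans (div_le_div_of_nonneg_right s1 h3.le)
    have s5 := s3.trans (div_le_div_of_nonneg_right s4 h4.le)
    refine (mul_le_mul_of_nonneg_left s5 hc.le).trans ?_
    rw [div_div, div_div, mul_one_div, div_le_iff₀ (by positivity)]
    nlinarith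
  have hsum : ∀ m, c * (Real.log (Real.log (Real.log ((N + m : ℕ) : ℝ)))
      - Real.log (Real.log (Real.log (N : ℝ)))) ≤
      ∑ i ∈ Finset.range m, ((N + i : ℕ) : ℝ) * d (N + i) := by
    intro m
    induction m with
    | zero => simp
    | succ m ih =>
      rw [Finset.sum_range_succ]
      have := hstep (N + m) (by omega)
      rw [← add_assoc]
      linarith
  have hs' : Summable fun i : ℕ => ((N + i : ℕ) : ℝ) * d (N + i) := by
    have := (summable_nat_add_iff N).2 hs
    simpa [add_comm] using this
  have t1 := hs'.tendsto_sum_tsum_nat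
  have t2 : Filter.Tendsto (fun m : ℕ => c * (Real.log (Real.log (Real.log ((N + m : ℕ) : ℝ)))
      - Real.log (Real.log (Real.log (N : ℝ))))) Filter.atTop Filter.atTop := by
    refine Filter.Tendsto.const_mul_atTop hc ?_
    refine Filter.tendsto_atTop_add_const_right _ _ ?_
    have : Filter.Tendsto (fun m : ℕ => N + m) Filter.atTop Filter.atTop :=
      Filter.tendsto_atTop_mono (fun m => Nat.le_add_left m N) Filter.tendsto_id
    exact l3.comp this
  exact not_tendsto_nhds_of_tendsto_atTop (Filter.tendsto_atTop_mono hsum t2) _ t1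

theorem nsa_summable (E d b e : ℕ → ℝ) (hE : ∀ k, 0 ≤ E k) (hd : ∀ k, 0 ≤ d k)
    (hb : ∀ k, 0 ≤ b k) (hbs : Summable b)
    (h : ∀ k, E (k + 1) + d k ≤ E k + b k) : Summable d := by
  refine summable_of_sum_range_le (c := E 0 + ∑' k, b k) hd (fun m => ?_)
  have : ∀ m, E m + ∑ i ∈ Finset.range m, d i ≤ E 0 + ∑ i ∈ Finset.range m, b i := by
    intro m
    induction m with
    | zero => simp
    | succ m ih => rw [Finset.sum_range_succ, Finset.sum_range_succ]; linarith [h m]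
  linarith [this m, hE m, hbs.sum_le_tsum (Finset.range m) (fun i _ => hb i)]

/-- Convergence of the NSA algorithm with inexact gradient oracles and
projection onto the ball `B_μ`: `k² δ_k → 0` and
`liminf k² log k log log k · δ_k = 0`. -/
theorem nsa_stmt_12 (n : ℕ) (hn : 1 ≤ n)
    (f : EuclideanSpace ℝ (Fin n) → ℝ)
    (hconv : ConvexOn ℝ Set.univ f)
    (hdiff : Differentiable ℝ f)
    (L : ℝ) (hL : 0 < L)
    (hlip : ∀ x x' : EuclideanSpace ℝ (Fin n),
      ‖gradient f x - gradient f x'‖ ≤ L * ‖x - x'‖)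
    (xstar : EuclideanSpace ℝ (Fin n)) (hmin : ∀ u, f xstar ≤ f u)
    (p : ℝ) (hp : 3 ≤ p)
    (η : ℝ) (hη0 : 0 < η) (hη : η ≤ 1 / (4 * L))
    (C : ℝ) (hC : 0 < C)
    (μ : ℝ) (hμ : 0 < μ) (hxstarμ : ‖xstar‖ ≤ μ)
    (α : ℕ → ℝ) (hα : ∀ k : ℕ, α k = p / (k + p))
    (ε : ℕ → ℝ) (hεpos : ∀ k, 0 ≤ ε k)
    (hεsum : Summable fun k : ℕ => ε k / α k)
    (x y z gy gx : ℕ → EuclideanSpace ℝ (Fin n))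
    (hx0 : x 0 = z 0) (hz0 : ‖z 0‖ ≤ μ)
    (hy : ∀ k, y k = (1 - α k) • x k + α k • z k)
    (hbias : ∀ k, ‖gy k - gradient f (y k)‖ ≤ C * ε k)
    (hangley : ∀ k, (3 / 4) * ‖gy k‖ ^ 2 ≤ ⟪gy k, gradient f (y k)⟫)
    (hanglex : ∀ k, (3 / 4) * ‖gx k‖ ^ 2 ≤ ⟪gx k, gradient f (x k)⟫)
    (hx : ∀ k, x (k + 1) =
      if f (y k - (2 * η) • gy k) ≤ f (x k - (2 * η) • gx k)
      then y k - (2 * η) • gy k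
      else x k - (2 * η) • gx k)
    (hzmem : ∀ k, z (k + 1) ∈ Metric.closedBall (0 : EuclideanSpace ℝ (Fin n)) μ)
    (hzproj : ∀ k, ∀ u ∈ Metric.closedBall (0 : EuclideanSpace ℝ (Fin n)) μ,
      ‖z k - (η / α k) • gy k - z (k + 1)‖ ≤ ‖z k - (η / α k) • gy k - u‖) :
    Filter.Tendsto (fun k : ℕ => (k : ℝ) ^ 2 * (f (x k) - f xstar))
      Filter.atTop (nhds 0) ∧
    Filter.liminf
      (fun k : ℕ =>
        (k : ℝ) ^ 2 * Real.log k * Real.log (Real.log k) * (f (x k) - f xstar))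
      Filter.atTop = 0 := by
  have hzμ : ∀ k, ‖z k‖ ≤ μ := by
    intro k
    cases k with
    | zero => exact hz0
    | succ k => simpa using hzmem k
  have hx1 : ∀ k, f (x (k + 1)) ≤ f (y k - (2 * η) • gy k) ∧
      f (x (k + 1)) ≤ f (x k - (2 * η) • gx k) := by
    intro k
    rw [hx k]
    split_ifs with h
    · exact ⟨le_rfl, h⟩
    · exact ⟨(not_le.1 h).le, le_rfl⟩
  have hanti : Antitone fun k => f (x k) - f xstar := by
    refine antitone_nat_of_succ_le fun k => ?_
    have h1 := (hx1 k).2.trans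
      (nsa_step f hconv hdiff L hL hlip η hη0 hη (x k) (gx k) (hanglex k))
    have : 0 ≤ η * ‖gx k‖ ^ 2 := by positivity
    linarith
  have hd0 : ∀ k, 0 ≤ f (x k) - f xstar := fun k => sub_nonneg.2 (hmin _)
  have hαpos : ∀ k, 0 < α k := fun k => by rw [hα]; positivity
  have hα1 : ∀ k, α k ≤ 1 := fun k => by
    rw [hα, div_le_one (by positivity)]
    linarith [(Nat.cast_nonneg k : (0 : ℝ) ≤ k)]
  have hp0 : 0 < p := by linarith
  have hS : Summable fun k : ℕ => η / p ^ 2 * ((k : ℝ) * (f (x k) - f xstar)) := by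
    refine nsa_summable
      (fun k => ‖z k - xstar‖ ^ 2 / 2 + η / p ^ 2 * (k + p - 1) ^ 2 * (f (x k) - f xstar))
      _ (fun k => η * C * (2 * μ) * (ε k / α k)) 0 ?_ ?_ ?_ (hεsum.mul_left _) ?_
    · intro k
      have := hd0 k
      positivity
    · intro k
      have := hd0 k
      positivity
    · intro k
      have := hεpos k
      have := hαpos k
      positivity
    · intro k
      have hF := (hx1 k).1.trans
        (nsa_step f hconv hdiff L hL hlip η hη0 hη (y k) (gy k) (hangley k))
      have hpr := nsa_proj μ (z k - (η / α k) • gy k) (z (k + 1)) xstar (hzmem k)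
        (by simpa using hxstarμ) (hzproj k)
      have := nsa_lyap f hconv hdiff η (α k) (C * ε k) μ hη0 (hαpos k) (hα1 k) xstar (x k) (y k)
        (z k) (z (k + 1)) (gy k) (f (x (k + 1))) hxstarμ (hzμ k) (hbias k) (hy k) hF hpr
      have hk : (0 : ℝ) ≤ k := Nat.cast_nonneg k
      have hkp : (0 : ℝ) < k + p := by linarith
      have e1 : η / α k ^ 2 = η / p ^ 2 * (k + p) ^ 2 := by rw [hα]; field_simp
      have e2 : η * (1 - α k) / α k ^ 2 = η / p ^ 2 * (k * (k + p)) := by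
        rw [hα]; field_simp; ring
      have e3 : η / α k * (C * ε k * (2 * μ)) = η * C * (2 * μ) * (ε k / α k) := by ring
      rw [e1, e2, e3] at this
      have h5 : η / p ^ 2 * (k * (k + p)) * (f (x k) - f xstar)
          + η / p ^ 2 * (k * (f (x k) - f xstar)) ≤
          η / p ^ 2 * (k + p - 1) ^ 2 * (f (x k) - f xstar) := by
        have : η / p ^ 2 * (k * (k + p) + k) * (f (x k) - f xstar) ≤
            η / p ^ 2 * (k + p - 1) ^ 2 * (f (x k) - f xstar) := by
          have := hd0 k
          gcongr
          nlinarith [mul_nonneg hk (sub_nonneg.2 hp), sq_nonneg (p - 1)]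
        linarith
      have e4 : ((k + 1 : ℕ) : ℝ) + p - 1 = k + p := by push_cast; ring
      simp only [e4]
      linarith
  have hS' : Summable fun k : ℕ => (k : ℝ) * (f (x k) - f xstar) :=
    (summable_mul_left_iff (by positivity)).1 hS
  refine ⟨nsa_tendsto _ hd0 hanti hS', ?_⟩
  rw [Filter.liminf_eq]
  refine IsGreatest.csSup_eq ⟨?_, ?_⟩
  · have hcast : Filter.Tendsto (fun k : ℕ => (k : ℝ)) Filter.atTop Filter.atTop :=
      tendsto_natCast_atTop_atTop
    have l1 := Real.tendsto_log_atTop.comp hcast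
    have l2 := Real.tendsto_log_atTop.comp l1
    filter_upwards [l1.eventually_ge_atTop 0, l2.eventually_ge_atTop 0] with k h1 h2
    simp only [Function.comp] at h1 h2
    have := hd0 k
    positivity
  · intro c hc
    by_contra hneg
    exact nsa_not_summable _ c (not_le.1 hneg) hc hS'
end

section
/- Let x ∈ ℝⁿ satisfy ∇f(x) ≠ 0. Then there exists ε₀ > 0 such that for every ε ∈ (0, ε₀], the central finite-difference gradient estimator satisfies (3/4)·‖G(x, ε)‖² ≤ ⟨G(x, ε), ∇f(x)⟩ ≤ (5/4)·‖G(x, ε)‖². -/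
open scoped RealInnerProductSpace

/-- The central finite-difference gradient estimator of `f` at `x` with
parameter `ε`. -/
noncomputable def centralFDGrad (n : ℕ) (f : EuclideanSpace ℝ (Fin n) → ℝ)
    (x : EuclideanSpace ℝ (Fin n)) (ε : ℝ) : EuclideanSpace ℝ (Fin n) :=
  (1 / (2 * ε)) •
    ∑ i : Fin n,
      (f (x + ε • EuclideanSpace.single i (1 : ℝ))
        - f (x - ε • EuclideanSpace.single i (1 : ℝ))) •
        EuclideanSpace.single i (1 : ℝ)

theorem centralFDGrad_tendsto (n : ℕ) (f : EuclideanSpace ℝ (Fin n) → ℝ)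
    (hdiff : Differentiable ℝ f) (x : EuclideanSpace ℝ (Fin n)) :
    Filter.Tendsto (fun ε : ℝ => centralFDGrad n f x ε) (nhdsWithin 0 (Set.Ioi 0))
      (nhds (gradient f x)) := by
  have key : ∀ i : Fin n, Filter.Tendsto (fun ε : ℝ => (1 / (2 * ε)) *
      (f (x + ε • EuclideanSpace.single i (1 : ℝ))
        - f (x - ε • EuclideanSpace.single i (1 : ℝ)))) (nhdsWithin 0 (Set.Ioi 0))
      (nhds (gradient f x i)) := by
    intro i
    set e : EuclideanSpace ℝ (Fin n) := EuclideanSpace.single i (1 : ℝ) with he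
    have hg : fderiv ℝ f x e = gradient f x i := by
      have h1 : ⟪gradient f x, e⟫ = fderiv ℝ f x e := by
        simp [gradient]
      rw [← h1, he, EuclideanSpace.inner_single_right]
      simp
    have hf := (hdiff x).hasFDerivAt
    have hp : HasDerivAt (fun t : ℝ => f (x + t • e)) (fderiv ℝ f x e) 0 := by
      have h2 : HasDerivAt (fun t : ℝ => x + t • e) e 0 := by
        simpa using ((hasDerivAt_id (0 : ℝ)).smul_const e).const_add x
      have hf' : HasFDerivAt f (fderiv ℝ f x) (x + (0 : ℝ) • e) := by simpa using hf
      exact hf'.comp_hasDerivAt (0 : ℝ) h2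
    have hm : HasDerivAt (fun t : ℝ => f (x - t • e)) (fderiv ℝ f x (-e)) 0 := by
      have h2 : HasDerivAt (fun t : ℝ => x - t • e) (-e) 0 := by
        simpa using ((hasDerivAt_id (0 : ℝ)).smul_const e).const_sub x
      have hf' : HasFDerivAt f (fderiv ℝ f x) (x - (0 : ℝ) • e) := by simpa using hf
      exact hf'.comp_hasDerivAt (0 : ℝ) h2
    have h3 := (hasDerivAt_iff_tendsto_slope_zero.1 (hp.sub hm)).mono_left
      (nhdsWithin_mono (0 : ℝ) (fun t (ht : 0 < t) => ne_of_gt ht))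
    have h4 := h3.const_mul (1 / 2 : ℝ)
    rw [map_neg, hg] at h4
    have h5 : (1 / 2 : ℝ) * (gradient f x i - -gradient f x i) = gradient f x i := by ring
    rw [h5] at h4
    refine h4.congr fun t => ?_
    simp
    ring
  have hx : gradient f x
      = ∑ i : Fin n, (gradient f x i) • EuclideanSpace.single i (1 : ℝ) := by
    ext j
    simp [Pi.single_apply]
  rw [hx]
  simp only [centralFDGrad, Finset.smul_sum, smul_smul]
  exact tendsto_finsetSum _ fun i _ => (key i).smul_const _

/-- If `∇f(x) ≠ 0`, then for all sufficiently small `ε > 0` the central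
finite-difference estimator satisfies the two-sided angle condition
`(3/4)‖G‖² ≤ ⟨G, ∇f(x)⟩ ≤ (5/4)‖G‖²`. -/
theorem nsa_stmt_19 (n : ℕ) (hn : 1 ≤ n)
    (f : EuclideanSpace ℝ (Fin n) → ℝ)
    (hdiff : Differentiable ℝ f)
    (L : ℝ) (hL : 0 < L)
    (hlip : ∀ x x' : EuclideanSpace ℝ (Fin n),
      ‖gradient f x - gradient f x'‖ ≤ L * ‖x - x'‖)
    (x : EuclideanSpace ℝ (Fin n)) (hgrad : gradient f x ≠ 0) :
    ∃ ε₀ : ℝ, 0 < ε₀ ∧ ∀ ε : ℝ, 0 < ε → ε ≤ ε₀ →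
      (3 / 4) * ‖centralFDGrad n f x ε‖ ^ 2 ≤
          ⟪centralFDGrad n f x ε, gradient f x⟫ ∧
        ⟪centralFDGrad n f x ε, gradient f x⟫ ≤
          (5 / 4) * ‖centralFDGrad n f x ε‖ ^ 2 := by
  have hG := centralFDGrad_tendsto n f hdiff x
  have hpos : 0 < ‖gradient f x‖ ^ 2 := by positivity
  have hN := (hG.norm).pow 2
  have hI := hG.inner (𝕜 := ℝ) (tendsto_const_nhds (x := gradient f x))
  rw [real_inner_self_eq_norm_sq] at hI
  have e1 := (hN.const_mul (3 / 4 : ℝ)).eventually_lt hI (by linarith)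
  have e2 := hI.eventually_lt (hN.const_mul (5 / 4 : ℝ)) (by linarith)
  obtain ⟨u, hu, h⟩ := mem_nhdsGT_iff_exists_Ioc_subset.1 (e1.and e2)
  refine ⟨u, hu, fun ε h0 h1 => ?_⟩
  have := h ⟨h0, h1⟩
  exact ⟨this.1.le, this.2.le⟩
end
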